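/- Let A be a simplicial Lie algebra over ℚ, let p, q ≥ 1, x ∈ A_p, y ∈ A_q, and 1 ≤ k ≤ p+q−1. Let (σ,τ) be a (p,q)-shuffle with k−1 ∈ σ and k ∈ τ, and let (σ',τ') be the (p,q)-shuffle obtained by exchanging these two entries, i.e. σ' = (σ∖{k−1}) ∪ {k} and τ' = (τ∖{k}) ∪ {k−1}. Then d_k([s_{τ_q} ⋯ s_{τ_1} x, s_{σ_p} ⋯ s_{σ_1} y]) = d_k([s_{τ'_q} ⋯ s_{τ'_1} x, s_{σ'_p} ⋯ s_{σ'_1} y]) and (−1)^{ε(σ')} = −(−1)^{ε(σ)}; hence the two corresponding summands of the shuffle bracket ⟦x,y⟧ cancel after applying d_k. -/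

import Mathlib

/-- A simplicial Lie algebra over `ℚ`: a family of `ℚ`-Lie algebras `A n` with
face maps `d n i : A n → A (n-1)` (meaningful for `0 ≤ i ≤ n`, `n ≥ 1`) and
degeneracy maps `s n j : A n → A (n+1)` (meaningful for `0 ≤ j ≤ n`), which are
Lie algebra homomorphisms satisfying the simplicial identities in the valid
ranges of indices. -/
structure SimplicialLieQ where
  A : ℕ → Type
  [lieRing : ∀ n, LieRing (A n)]
  [lieAlgebra : ∀ n, LieAlgebra ℚ (A n)]
  d : ∀ n : ℕ, ℕ → A n →ₗ⁅ℚ⁆ A (n - 1)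
  s : ∀ n : ℕ, ℕ → A n →ₗ⁅ℚ⁆ A (n + 1)
  dd : ∀ (n i j : ℕ), i < j → j ≤ n + 2 → ∀ x : A (n + 2),
    d (n + 1) i (d (n + 2) j x) = d (n + 1) (j - 1) (d (n + 2) i x)
  ss : ∀ (n i j : ℕ), i ≤ j → j ≤ n → ∀ x : A n,
    s (n + 1) i (s n j x) = s (n + 1) (j + 1) (s n i x)
  ds_lt : ∀ (n i j : ℕ), i < j → j ≤ n + 1 → ∀ x : A (n + 1),
    d (n + 2) i (s (n + 1) j x) = s n (j - 1) (d (n + 1) i x)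
  ds_eq : ∀ (n j : ℕ), j ≤ n → ∀ x : A n, d (n + 1) j (s n j x) = x
  ds_eq' : ∀ (n j : ℕ), j ≤ n → ∀ x : A n, d (n + 1) (j + 1) (s n j x) = x
  ds_gt : ∀ (n i j : ℕ), j + 1 < i → i ≤ n + 2 → ∀ x : A (n + 1),
    d (n + 2) i (s (n + 1) j x) = s n j (d (n + 1) (i - 1) x)

attribute [instance] SimplicialLieQ.lieRing SimplicialLieQ.lieAlgebra

namespace SimplicialLieQ

/-- Iterated degeneracies: `iterS n k f x = s (f (k-1)) (⋯ (s (f 1) (s (f 0) x)))`,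
i.e. `s (f 0)` is applied first (innermost). -/
def iterS (X : SimplicialLieQ) (n : ℕ) : (k : ℕ) → (Fin k → ℕ) → X.A n → X.A (n + k)
  | 0, _, x => x
  | k + 1, f, x => X.s (n + k) (f (Fin.last k)) (X.iterS n k (fun i => f i.castSucc) x)

end SimplicialLieQ

/-- For a subset `σ = {σ_1 < … < σ_p}` of `{0,…,m-1}` (with `p = σ.card`), the
exponent `ε(σ) = p + ∑_{i=1}^p (σ_i - i)`, computed in `ℤ`; here
`∑_{i=1}^p σ_i = ∑_{a ∈ σ} a` and `∑_{i=1}^p i = ∑_{i ∈ range p} (i+1)`. -/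
def shuffleSign {m : ℕ} (σ : Finset (Fin m)) : ℤ :=
  (σ.card : ℤ) + ((∑ a ∈ σ, ((a : ℕ) : ℤ)) - ∑ i ∈ Finset.range σ.card, ((i : ℤ) + 1))

lemma card_compl_shuffle {p q : ℕ} (σ : Finset (Fin (p + q))) (h : σ.card = p) :
    σᶜ.card = q := by
  have hc := Finset.card_compl σ
  rw [h, Fintype.card_fin] at hc
  omega

namespace SimplicialLieQ

/-- The summand of the shuffle bracket corresponding to a `(p,q)`-shuffle `(σ, τ)`
(with `τ = σᶜ`): `[s_{τ_q} ⋯ s_{τ_1} x, s_{σ_p} ⋯ s_{σ_1} y]`. -/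
noncomputable def shuffleTerm (X : SimplicialLieQ) {p q : ℕ} (x : X.A p) (y : X.A q)
    (σ : Finset (Fin (p + q))) (h : σ.card = p) : X.A (p + q) :=
  ⁅X.iterS p q (fun j => ((σᶜ.orderEmbOfFin (card_compl_shuffle σ h)) j : ℕ)) x,
   cast (congrArg X.A (Nat.add_comm q p))
     (X.iterS q p (fun i => ((σ.orderEmbOfFin h) i : ℕ)) y)⁆

/-- The shuffle bracket
`⟦x,y⟧ = ∑_{(σ,τ) ∈ S_{p,q}} (-1)^{ε(σ)} [s_{τ_q} ⋯ s_{τ_1} x, s_{σ_p} ⋯ s_{σ_1} y]`. -/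
noncomputable def shuffleBracket (X : SimplicialLieQ) {p q : ℕ}
    (x : X.A p) (y : X.A q) : X.A (p + q) :=
  ∑ σ : Finset (Fin (p + q)),
    if h : σ.card = p then ((-1 : ℚ) ^ shuffleSign σ) • X.shuffleTerm x y σ h else 0

end SimplicialLieQ

/-- A strictly increasing sequence of length `r` with values below `n + r` satisfies
`g j ≤ n + j`. -/
lemma StrictMono.le_add_of_lt_add {n r : ℕ} {g : Fin r → ℕ} (hg : StrictMono g)
    (hlt : ∀ j, g j < n + r) (j : Fin r) : g j ≤ n + j := by
  have key : ∀ (e : ℕ) (i : Fin r), (i : ℕ) + e + 1 = r → g i + e < n + r := by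
    intro e
    induction e with
    | zero => intro i _; exact hlt i
    | succ e ih =>
      intro i hi
      have h₁ := ih ⟨i + 1, by omega⟩ (by simp only; omega)
      have h₂ : g i < g ⟨i + 1, by omega⟩ := hg (Fin.lt_def.2 (by simp))
      omega
  have := key (r - 1 - j) j (by omega)
  omega

/-- Replacing an element of a finset of `Fin m` by its successor changes the increasing
enumeration in exactly one place. -/
lemma Finset.orderEmbOfFin_insert_erase {m r : ℕ} {S T : Finset (Fin m)} (hS : S.card = r)
    (hT : T.card = r) {a b : Fin m} (hab : (b : ℕ) = a + 1) (hb : b ∉ S)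
    (hTS : T = insert b (S.erase a)) {i : Fin r} (hi : S.orderEmbOfFin hS i = a) :
    ⇑(T.orderEmbOfFin hT) = Function.update (S.orderEmbOfFin hS) i b := by
  have hmono := (S.orderEmbOfFin hS).strictMono
  have hne : ∀ j, S.orderEmbOfFin hS j ≠ b := fun j h =>
    hb (h ▸ S.orderEmbOfFin_mem hS j)
  symm
  apply Finset.orderEmbOfFin_unique
  · intro j
    rw [hTS]
    by_cases hj : j = i
    · simp [hj]
    · rw [Function.update_of_ne hj]
      refine Finset.mem_insert_of_mem (Finset.mem_erase.2 ⟨?_, S.orderEmbOfFin_mem hS j⟩)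
      rw [← hi]
      exact fun h => hj ((S.orderEmbOfFin hS).injective h)
  · intro j l hjl
    by_cases hj : j = i
    · subst hj
      rw [Function.update_self, Function.update_of_ne hjl.ne']
      have h₁ := hmono hjl
      have h₂ := hne l
      rw [hi] at h₁
      simp only [Fin.lt_def, ne_eq, Fin.ext_iff] at *
      omega
    · rw [Function.update_of_ne hj]
      have h₁ := hmono hjl
      by_cases hl : l = i
      · subst hl
        rw [Function.update_self]
        rw [hi] at h₁
        simp only [Fin.lt_def] at *
        omega
      · rwa [Function.update_of_ne hl]

/-- Replacing an element by its successor flips the sign of a shuffle. -/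
lemma neg_one_zpow_shuffleSign_insert_erase {m : ℕ} {S T : Finset (Fin m)} {a b : Fin m}
    (hab : (b : ℕ) = a + 1) (ha : a ∈ S) (hb : b ∉ S) (hTS : T = insert b (S.erase a))
    (hcard : T.card = S.card) :
    (-1 : ℚ) ^ shuffleSign T = -((-1 : ℚ) ^ shuffleSign S) := by
  have hsum : ∑ c ∈ T, ((c : ℕ) : ℤ) = ∑ c ∈ S, ((c : ℕ) : ℤ) + 1 := by
    rw [hTS, Finset.sum_insert (fun h => hb (Finset.mem_of_mem_erase h)),
      ← Finset.add_sum_erase S _ ha, hab]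
    push_cast
    ring
  have hsign : shuffleSign T = shuffleSign S + 1 := by
    simp only [shuffleSign, hcard, hsum]
    ring
  rw [hsign, zpow_add_one₀ (by norm_num), mul_neg_one]

namespace SimplicialLieQ

/-- The face `d_{k+1}` does not distinguish iterated degeneracies that differ only by having
`s_k` or `s_{k+1}` at position `i`, provided all later degeneracies have larger indices. -/
lemma d_iterS_update (X : SimplicialLieQ) (n k : ℕ) (x : X.A n) (r : ℕ) (f : Fin r → ℕ)
    (i : Fin r) (hi : f i = k) (hgt : ∀ j, i < j → k + 1 < f j) (hle : ∀ j, f j ≤ n + j)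
    (hk : k + 1 ≤ n + i) :
    X.d (n + r) (k + 1) (X.iterS n r f x) =
      X.d (n + r) (k + 1) (X.iterS n r (Function.update f i (k + 1)) x) := by
  induction r with
  | zero => exact i.elim0
  | succ r ih =>
    induction i using Fin.lastCases with
    | last =>
      have hrest : (fun j : Fin r => Function.update f (Fin.last r) (k + 1) j.castSucc) =
          fun j => f j.castSucc :=
        funext fun j => Function.update_of_ne (Fin.castSucc_lt_last j).ne _ _
      simp only [iterS, Function.update_self, hrest, hi]
      rw [Fin.val_last] at hk
      exact (X.ds_eq' (n + r) k (by omega) _).trans (X.ds_eq (n + r) (k + 1) hk _).symm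
    | cast i =>
      cases r with
      | zero => exact i.elim0
      | succ r =>
        have hrest : (fun j : Fin (r + 1) =>
            Function.update f i.castSucc (k + 1) j.castSucc) =
            Function.update (fun j : Fin (r + 1) => f j.castSucc) i (k + 1) :=
          Function.update_comp_eq_of_injective f (Fin.castSucc_injective _) i (k + 1)
        have hlast : Function.update f i.castSucc (k + 1) (Fin.last (r + 1)) =
            f (Fin.last (r + 1)) := Function.update_of_ne (Fin.castSucc_lt_last i).ne' _ _
        have hl := hgt _ (Fin.castSucc_lt_last i)
        have hl' := hle (Fin.last (r + 1))
        rw [Fin.val_last] at hl'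
        have hd := X.ds_lt (n + r) (k + 1) (f (Fin.last (r + 1))) hl hl'
        have hsucc : ∀ g : Fin (r + 2) → ℕ, X.iterS n (r + 2) g x =
            X.s (n + (r + 1)) (g (Fin.last (r + 1)))
              (X.iterS n (r + 1) (fun j => g j.castSucc) x) := fun _ => rfl
        rw [hsucc f, hsucc (Function.update f i.castSucc (k + 1)), hrest, hlast]
        refine (hd _).trans (Eq.trans ?_ (hd _).symm)
        exact congrArg _ (ih (fun j => f j.castSucc) i hi (fun j hj => hgt _ hj)
          (fun j => hle _) hk)

/-- The face `d_{k+1}` does not distinguish the iterated degeneracies along `S` and along the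
set obtained from `S` by replacing `k` with `k + 1`. -/
lemma d_iterS_orderEmbOfFin (X : SimplicialLieQ) {n r m : ℕ} (hm : m = n + r) (x : X.A n)
    {S T : Finset (Fin m)} (hS : S.card = r) (hT : T.card = r) {a b : Fin m}
    (hab : (b : ℕ) = a + 1) (ha : a ∈ S) (hb : b ∉ S) (hTS : T = insert b (S.erase a)) :
    X.d (n + r) b (X.iterS n r (fun j => (S.orderEmbOfFin hS j : ℕ)) x) =
      X.d (n + r) b (X.iterS n r (fun j => (T.orderEmbOfFin hT j : ℕ)) x) := by
  obtain ⟨i, hi⟩ : ∃ i, S.orderEmbOfFin hS i = a := by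
    have : a ∈ Set.range (S.orderEmbOfFin hS) := by
      rw [Finset.range_orderEmbOfFin]; exact ha
    exact this
  have hT' := Finset.orderEmbOfFin_insert_erase hS hT hab hb hTS hi
  have hupd : (fun j => (T.orderEmbOfFin hT j : ℕ)) =
      Function.update (fun j => (S.orderEmbOfFin hS j : ℕ)) i (a + 1) := by
    funext j
    rw [hT']
    by_cases hj : j = i
    · subst hj; simp [hab]
    · simp [hj]
  have hle : ∀ (U : Finset (Fin m)) (hU : U.card = r) (j : Fin r),
      (U.orderEmbOfFin hU j : ℕ) ≤ n + j := fun U hU =>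
    StrictMono.le_add_of_lt_add (fun _ _ h => (U.orderEmbOfFin hU).strictMono h)
      fun j => hm ▸ (U.orderEmbOfFin hU j).isLt
  rw [hupd, hab]
  refine X.d_iterS_update n a x r _ i (congrArg _ hi) (fun j hj => ?_) (hle S hS) ?_
  · have h₁ := (S.orderEmbOfFin hS).strictMono hj
    have h₂ : S.orderEmbOfFin hS j ≠ b := fun h => hb (h ▸ S.orderEmbOfFin_mem hS j)
    rw [hi] at h₁
    simp only [Fin.lt_def, ne_eq, Fin.ext_iff] at h₁ h₂
    omega
  · simpa [hT', hab] using hle T hT i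

/-- Faces commute with transport along an equality of degrees. -/
lemma d_cast_congr (X : SimplicialLieQ) {m n : ℕ} (h : m = n) (k : ℕ) {u v : X.A m}
    (huv : X.d m k u = X.d m k v) :
    X.d n k (cast (congrArg X.A h) u) = X.d n k (cast (congrArg X.A h) v) := by
  subst h
  exact huv

/-- Replacing `a` by its successor `b` in a shuffle does not change the face `d_b` of the
corresponding summand of the shuffle bracket. -/
lemma d_shuffleTerm_insert_erase (X : SimplicialLieQ) {p q : ℕ} (x : X.A p) (y : X.A q)
    {σ σ' : Finset (Fin (p + q))} (hσ : σ.card = p) (hσ' : σ'.card = p) {a b : Fin (p + q)}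
    (hab : (b : ℕ) = a + 1) (ha : a ∈ σ) (hb : b ∉ σ) (hins : σ' = insert b (σ.erase a)) :
    X.d (p + q) b (X.shuffleTerm x y σ hσ) = X.d (p + q) b (X.shuffleTerm x y σ' hσ') := by
  have hne : a ≠ b := fun h => hb (h ▸ ha)
  have hx := X.d_iterS_orderEmbOfFin rfl x (card_compl_shuffle σ' hσ')
    (card_compl_shuffle σ hσ) hab (by simp [hins, hne]) (by simp [hins])
    (by
      ext c
      simp only [hins, Finset.mem_compl, Finset.mem_insert, Finset.mem_erase]
      grind)
  have hy := X.d_cast_congr (Nat.add_comm q p) b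
    (X.d_iterS_orderEmbOfFin (Nat.add_comm p q) y hσ hσ' hab ha hb hins)
  rw [shuffleTerm, shuffleTerm, LieHom.map_lie, LieHom.map_lie, hx, hy]

end SimplicialLieQ

/-- Let `A` be a simplicial Lie algebra over `ℚ`, `p, q ≥ 1`,
`x ∈ A_p`, `y ∈ A_q`, and `1 ≤ k ≤ p+q-1`.  Let `(σ, τ)` be a `(p,q)`-shuffle
(`τ = σᶜ`) with `k-1 ∈ σ` and `k ∈ τ`, and let `(σ', τ')` be the `(p,q)`-shuffle
obtained by exchanging these two entries: `σ' = (σ∖{k-1}) ∪ {k}`.  Then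
`d_k [s_{τ_q}⋯s_{τ_1}x, s_{σ_p}⋯s_{σ_1}y] = d_k [s_{τ'_q}⋯s_{τ'_1}x, s_{σ'_p}⋯s_{σ'_1}y]`
and `(-1)^{ε(σ')} = -(-1)^{ε(σ)}`; hence the two corresponding summands of the
shuffle bracket `⟦x,y⟧` cancel after applying `d_k`. -/
theorem shuffle_summands_cancel (X : SimplicialLieQ) (p q : ℕ) (hp : 1 ≤ p) (hq : 1 ≤ q)
    (x : X.A p) (y : X.A q) (k : ℕ) (hk1 : 1 ≤ k) (hk2 : k ≤ p + q - 1)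
    (σ : Finset (Fin (p + q))) (hσ : σ.card = p)
    (hmem : (⟨k - 1, by omega⟩ : Fin (p + q)) ∈ σ)
    (hmem' : (⟨k, by omega⟩ : Fin (p + q)) ∉ σ)
    (σ' : Finset (Fin (p + q)))
    (hσ'def : σ' = insert (⟨k, by omega⟩ : Fin (p + q)) (σ.erase ⟨k - 1, by omega⟩))
    (hσ' : σ'.card = p) :
    X.d (p + q) k (X.shuffleTerm x y σ hσ) = X.d (p + q) k (X.shuffleTerm x y σ' hσ') ∧
    ((-1 : ℚ) ^ shuffleSign σ') = -((-1 : ℚ) ^ shuffleSign σ) ∧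
    X.d (p + q) k (((-1 : ℚ) ^ shuffleSign σ) • X.shuffleTerm x y σ hσ +
      ((-1 : ℚ) ^ shuffleSign σ') • X.shuffleTerm x y σ' hσ') = 0 := by
  have hab : ((⟨k, by omega⟩ : Fin (p + q)) : ℕ) = (⟨k - 1, by omega⟩ : Fin (p + q)) + 1 := by
    simp only
    omega
  have hd : X.d (p + q) k (X.shuffleTerm x y σ hσ) = X.d (p + q) k (X.shuffleTerm x y σ' hσ') :=
    X.d_shuffleTerm_insert_erase x y hσ hσ' hab hmem hmem' hσ'def
  have hsign := neg_one_zpow_shuffleSign_insert_erase hab hmem hmem' hσ'def (hσ'.trans hσ.symm)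
  refine ⟨hd, hsign, ?_⟩
  rw [map_add, map_smul, map_smul, hd, hsign, neg_smul, add_neg_cancel]
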